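/- Suppose a ∈ A ∪ B has degree 2 in G with distinct neighbors u and v, and suppose a solution to Disjoint A,B-paths on G exists. Let G′ be obtained from G by deleting the edges ua and av, adding three new nonterminal vertices u′, v′, w, and adding the edges uu′ of length ℓ(ua), v′v of length ℓ(av), and u′a, u′w, aw, av′, wv′ each of length 1 (terminal sets unchanged). Then: (i) every minimum-length solution of Disjoint A,B-paths on G′ uses, among the new edges, exactly the two edges of the path a,u′,u or exactly the two edges of the path a,v′,v, and in particular no minimum-length solution uses the vertex w; (ii) ℓ_{A,B}(G′) = ℓ_{A,B}(G) + 1; and (iii) the minimum-length solutions of G′ are in bijection with the minimum-length solutions of G, so S_{A,B}(G′) = S_{A,B}(G). -/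

import Mathlib

/-- `f` is a family of `(|A|+|B|)/2` pairwise vertex-disjoint simple paths of `G`,
each with both endpoints in `A` or both endpoints in `B`, such that every vertex of
`A ∪ B` is an endpoint of one of the paths, and `E'` is the union of their edge
sets.  This witnesses that `E'` is a solution to Disjoint `A`,`B`-paths. -/
def IsPathFamily {V : Type} [DecidableEq V] (G : SimpleGraph V) (A B : Finset V)
    (E' : Set (Sym2 V)) {k : ℕ} (f : Fin k → (u : V) × (v : V) × G.Walk u v) : Prop :=
  k = (A.card + B.card) / 2 ∧
  (∀ i, (f i).2.2.IsPath) ∧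
  (∀ i, ((f i).1 ∈ A ∧ (f i).2.1 ∈ A) ∨ ((f i).1 ∈ B ∧ (f i).2.1 ∈ B)) ∧
  (∀ i j, i ≠ j → ∀ x, x ∈ (f i).2.2.support → x ∉ (f j).2.2.support) ∧
  (∀ z, z ∈ A ∪ B → ∃ i, z = (f i).1 ∨ z = (f i).2.1) ∧
  E' = ⋃ i, {e | e ∈ (f i).2.2.edges}

/-- `E'` is a solution to Disjoint `A`,`B`-paths on `G`. -/
def IsSolution {V : Type} [DecidableEq V] (G : SimpleGraph V) (A B : Finset V)
    (E' : Set (Sym2 V)) : Prop :=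
  ∃ (k : ℕ) (f : Fin k → (u : V) × (v : V) × G.Walk u v), IsPathFamily G A B E' f

/-- The length of an edge set: the sum of the lengths of its edges. -/
noncomputable def lengthOf {V : Type} (ℓ : Sym2 V → ℕ) (E' : Set (Sym2 V)) : ℕ :=
  ∑ᶠ e ∈ E', ℓ e

/-- `ℓ_{A,B}`: the minimum length of a solution to Disjoint `A`,`B`-paths. -/
noncomputable def lAB {V : Type} [DecidableEq V] (G : SimpleGraph V) (A B : Finset V)
    (ℓ : Sym2 V → ℕ) : ℕ :=
  sInf {n | ∃ E', IsSolution G A B E' ∧ lengthOf ℓ E' = n}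

/-- `S_{A,B}`: the number of minimum-length solutions to Disjoint `A`,`B`-paths. -/
noncomputable def nSol {V : Type} [DecidableEq V] (G : SimpleGraph V) (A B : Finset V)
    (ℓ : Sym2 V → ℕ) : ℕ :=
  Set.ncard {E' | IsSolution G A B E' ∧ lengthOf ℓ E' = lAB G A B ℓ}

open SimpleGraph

lemma Set.iUnion_eq_of_forall_ne {ι α : Type*} (S : ι → Set α) (i₀ : ι)
    (h : ∀ i, i ≠ i₀ → S i = ∅) : ⋃ i, S i = S i₀ := by
  refine Set.Subset.antisymm (Set.iUnion_subset fun i => ?_) (Set.subset_iUnion S i₀)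
  obtain rfl | hi := eq_or_ne i i₀
  · exact subset_rfl
  · simp [h i hi]

section PathFamily

variable {V : Type} [DecidableEq V] {G : SimpleGraph V} {A B : Finset V} {E : Set (Sym2 V)}
  {k : ℕ} {f : Fin k → (u : V) × (v : V) × G.Walk u v}

/-- By counting, the `2k` endpoints of the paths of a family are pairwise distinct. -/
lemma IsPathFamily.endpoint_injective (hf : IsPathFamily G A B E f) (hd : Disjoint A B)
    (hA : Even A.card) (hB : Even B.card) :
    Function.Injective fun j : Fin k × Bool => if j.2 then (f j.1).1 else (f j.1).2.1 := by
  obtain ⟨hk, -, hend, -, hcov, -⟩ := hf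
  rw [← Set.injOn_univ, ← Finset.coe_univ, ← Finset.card_image_iff]
  have himg : Finset.univ.image
      (fun j : Fin k × Bool => if j.2 then (f j.1).1 else (f j.1).2.1) = A ∪ B := by
    ext c
    simp only [Finset.mem_image, Finset.mem_univ, true_and, Prod.exists, Bool.exists_bool,
      Bool.false_eq_true, if_false, if_true]
    refine ⟨?_, fun hc => ?_⟩
    · rintro ⟨i, rfl | rfl⟩ <;> rw [Finset.mem_union] <;> have := hend i <;> tauto
    · obtain ⟨i, hi⟩ := hcov c hc
      exact ⟨i, hi.symm.imp Eq.symm Eq.symm⟩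
  rw [himg, Finset.card_union_of_disjoint hd, Finset.card_univ, Fintype.card_prod,
    Fintype.card_fin, Fintype.card_bool]
  obtain ⟨m, hm⟩ := hA
  obtain ⟨n, hn⟩ := hB
  omega

lemma IsPathFamily.fst_ne_snd (hf : IsPathFamily G A B E f) (hd : Disjoint A B)
    (hA : Even A.card) (hB : Even B.card) (i : Fin k) : (f i).1 ≠ (f i).2.1 := by
  intro h
  have := hf.endpoint_injective hd hA hB (a₁ := (i, true)) (a₂ := (i, false)) (by simpa using h)
  simp at this

lemma IsPathFamily.eq_of_mem_support (hf : IsPathFamily G A B E f) {c : V} (hc : c ∈ A ∪ B)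
    {i : Fin k} (hi : c ∈ (f i).2.2.support) : (f i).1 = c ∨ (f i).2.1 = c := by
  obtain ⟨-, -, -, hdis, hcov, -⟩ := hf
  obtain ⟨j, hj⟩ := hcov c hc
  obtain rfl | hij := eq_or_ne j i
  · exact hj.imp Eq.symm Eq.symm
  · refine absurd hi (hdis j i hij c ?_)
    rcases hj with hj | hj <;> rw [hj]
    · exact Walk.start_mem_support _
    · exact Walk.end_mem_support _

lemma IsPathFamily.exists_mem_support (hf : IsPathFamily G A B E f) {c : V} (hc : c ∈ A ∪ B) :
    ∃ i, c ∈ (f i).2.2.support := by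
  obtain ⟨i, hi⟩ := hf.2.2.2.2.1 c hc
  refine ⟨i, ?_⟩
  rcases hi with hi | hi <;> rw [hi]
  · exact Walk.start_mem_support _
  · exact Walk.end_mem_support _

end PathFamily

/-- `G'` arises from `G` by rerouting the two edges `as` and `at` at the degree-two vertex `a`
through the new vertices `x`, `y`, `z`, where `x` is attached to `s`, `y` to `t`, and `a` and `z`
to both `x` and `y`, and `a` to `z`. -/
structure IsDetour {V : Type} (G : SimpleGraph V) (a s t : V) (G' : SimpleGraph (V ⊕ Fin 3))
    (x y z : Fin 3) : Prop where
  adj_iff : ∀ p, G.Adj a p ↔ p = s ∨ p = t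
  adj_inl : ∀ p q, G'.Adj (Sum.inl p) (Sum.inl q) ↔ G.Adj p q ∧ p ≠ a ∧ q ≠ a
  adj_x : ∀ p, G'.Adj (Sum.inr x) (Sum.inl p) ↔ p = s ∨ p = a
  adj_y : ∀ p, G'.Adj (Sum.inr y) (Sum.inl p) ↔ p = t ∨ p = a
  adj_z : ∀ p, G'.Adj (Sum.inr z) (Sum.inl p) ↔ p = a
  adj_xz : G'.Adj (Sum.inr x) (Sum.inr z)
  adj_yz : G'.Adj (Sum.inr y) (Sum.inr z)
  not_adj_xy : ¬ G'.Adj (Sum.inr x) (Sum.inr y)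
  hxy : x ≠ y
  hxz : x ≠ z
  hyz : y ≠ z

/-- The edge sets of the three paths from `a` to `s` inside the gadget. -/
def IsRoute {V : Type} (a s : V) (x y z : Fin 3) (Q : Set (Sym2 (V ⊕ Fin 3))) : Prop :=
  Q = {s(Sum.inl a, Sum.inr x), s(Sum.inl s, Sum.inr x)} ∨
  Q = {s(Sum.inl a, Sum.inr z), s(Sum.inr x, Sum.inr z), s(Sum.inl s, Sum.inr x)} ∨
  Q = {s(Sum.inl a, Sum.inr y), s(Sum.inr y, Sum.inr z), s(Sum.inr x, Sum.inr z),
    s(Sum.inl s, Sum.inr x)}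

namespace IsDetour

variable {V : Type} {G : SimpleGraph V} {a s t : V} {G' : SimpleGraph (V ⊕ Fin 3)} {x y z : Fin 3}

lemma symm (h : IsDetour G a s t G' x y z) : IsDetour G a t s G' y x z where
  adj_iff p := (h.adj_iff p).trans or_comm
  adj_inl := h.adj_inl
  adj_x := h.adj_y
  adj_y := h.adj_x
  adj_z := h.adj_z
  adj_xz := h.adj_yz
  adj_yz := h.adj_xz
  not_adj_xy hadj := h.not_adj_xy hadj.symm
  hxy := h.hxy.symm
  hxz := h.hyz
  hyz := h.hxz

lemma eq_or_eq_or_eq (h : IsDetour G a s t G' x y z) (j : Fin 3) : j = x ∨ j = y ∨ j = z := by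
  have := h.hxy; have := h.hxz; have := h.hyz
  omega

lemma s_ne (h : IsDetour G a s t G' x y z) : s ≠ a :=
  ((h.adj_iff s).2 (Or.inl rfl)).ne'

/-- A path avoiding `a` that starts at `x` leaves the gadget directly to `s` or through `z` and `y`
to `t`. -/
lemma exists_leaving_x (h : IsDetour G a s t G' x y z) {q : V} (P : G'.Walk (Sum.inr x) (Sum.inl q))
    (hP : P.IsPath) (ha : Sum.inl a ∉ P.support) :
    (∃ R : G'.Walk (Sum.inl s) (Sum.inl q), R.IsPath ∧
      P.edges = s(Sum.inr x, Sum.inl s) :: R.edges ∧ P.support = Sum.inr x :: R.support) ∨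
    (∃ R : G'.Walk (Sum.inl t) (Sum.inl q), R.IsPath ∧
      P.edges = s(Sum.inr x, Sum.inr z) :: s(Sum.inr z, Sum.inr y) :: s(Sum.inr y, Sum.inl t)
        :: R.edges ∧
      P.support = Sum.inr x :: Sum.inr z :: Sum.inr y :: R.support) := by
  rcases P with _ | ⟨hadj, P⟩
  rename_i c
  rw [Walk.cons_isPath_iff] at hP
  simp only [Walk.support_cons, List.mem_cons, not_or] at ha
  rcases c with c | j
  · obtain rfl | rfl := (h.adj_x c).1 hadj
    · exact Or.inl ⟨P, hP.1, by simp, by simp⟩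
    · exact absurd P.start_mem_support ha.2
  · right
    obtain rfl | rfl | rfl := h.eq_or_eq_or_eq j
    · exact absurd rfl hadj.ne
    · exact absurd hadj h.not_adj_xy
    rcases P with _ | ⟨hadj₂, P⟩
    rename_i c
    rw [Walk.cons_isPath_iff] at hP
    simp only [Walk.support_cons, List.mem_cons, not_or] at ha hP
    rcases c with c | i
    · obtain rfl := (h.adj_z c).1 hadj₂
      exact absurd P.start_mem_support ha.2.2
    obtain rfl | rfl | rfl := h.eq_or_eq_or_eq i
    · exact absurd P.start_mem_support hP.2.2
    swap
    · exact absurd rfl hadj₂.ne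
    rcases P with _ | ⟨hadj₃, P⟩
    rename_i c
    rw [Walk.cons_isPath_iff] at hP
    simp only [Walk.support_cons, List.mem_cons, not_or] at ha hP
    rcases c with c | i
    · obtain rfl | rfl := (h.adj_y c).1 hadj₃
      · exact ⟨P, hP.1.1.1, by simp, by simp⟩
      · exact absurd P.start_mem_support ha.2.2.2
    obtain rfl | rfl | rfl := h.eq_or_eq_or_eq i
    · exact absurd hadj₃.symm h.not_adj_xy
    · exact absurd rfl hadj₃.ne
    · exact absurd P.start_mem_support hP.1.2.2

lemma inr_notMem_or_mem (h : IsDetour G a s t G' x y z) {p q : V ⊕ Fin 3} (P : G'.Walk p q)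
    (hP : P.IsPath) (ha : Sum.inl a ∉ P.support) (hp : p.isLeft) (hq : q.isLeft) :
    (∀ j, Sum.inr j ∉ P.support) ∨ ∀ j, Sum.inr j ∈ P.support := by
  induction P with
  | nil => left; rintro j hj; simp at hj; simp [← hj] at hp
  | @cons p c q hadj P ih =>
    rw [Walk.cons_isPath_iff] at hP
    simp only [Walk.support_cons, List.mem_cons, not_or] at ha
    obtain ⟨p, rfl⟩ := Sum.isLeft_iff.1 hp
    obtain ⟨q, rfl⟩ := Sum.isLeft_iff.1 hq
    rcases c with c | j
    · simpa using ih hP.1 ha.2 rfl hq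
    · right
      suffices ∀ {s t x y}, IsDetour G a s t G' x y z → j = x → ∀ i, Sum.inr i ∈ P.support by
        intro i
        rw [Walk.support_cons]
        refine List.mem_cons_of_mem _ ?_
        obtain hj | hj | rfl := h.eq_or_eq_or_eq j
        · exact this h hj i
        · exact this h.symm hj i
        · exact absurd ((h.adj_z p).1 hadj.symm) (fun e => ha.1 (by rw [e]))
      rintro s t x y h rfl i
      obtain rfl | rfl := (h.adj_x p).1 hadj.symm
      · obtain ⟨R, -, -, hs⟩ | ⟨R, -, -, hs⟩ := h.exists_leaving_x P hP.1 ha.2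
        · exact absurd (by simp [hs]) hP.2
        · rw [hs]
          obtain rfl | rfl | rfl := h.eq_or_eq_or_eq i <;> simp
      · exact absurd rfl ha.1

lemma descend (h : IsDetour G a s t G' x y z) {p' q' : V ⊕ Fin 3} (P : G'.Walk p' q')
    (hr : ∀ j, Sum.inr j ∉ P.support) {p q : V} (hp : p' = Sum.inl p) (hq : q' = Sum.inl q) :
    ∃ R : G.Walk p q, P.edges = R.edges.map (Sym2.map Sum.inl) ∧
      P.support = R.support.map Sum.inl := by
  induction P generalizing p with
  | nil =>
    subst hp
    obtain rfl := Sum.inl_injective hq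
    exact ⟨Walk.nil, by simp, by simp⟩
  | @cons p' c q' hadj P ih =>
    subst hp hq
    rcases c with c | j
    · obtain ⟨R, h₁, h₂⟩ := ih (fun j hj => hr j (by simp [hj])) rfl rfl
      exact ⟨Walk.cons ((h.adj_inl _ _).1 hadj).1 R, by simp [h₁], by simp [h₂]⟩
    · exact absurd (by simp) (hr j)

lemma lift (h : IsDetour G a s t G' x y z) {p q : V} (R : G.Walk p q) (ha : a ∉ R.support) :
    ∃ P : G'.Walk (Sum.inl p) (Sum.inl q), P.edges = R.edges.map (Sym2.map Sum.inl) ∧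
      P.support = R.support.map Sum.inl := by
  induction R with
  | nil => exact ⟨Walk.nil, by simp, by simp⟩
  | @cons p c q hadj R ih =>
    simp only [Walk.support_cons, List.mem_cons, not_or] at ha
    obtain ⟨P, h₁, h₂⟩ := ih ha.2
    exact ⟨Walk.cons ((h.adj_inl _ _).2 ⟨hadj, Ne.symm ha.1,
      fun e => ha.2 (e ▸ R.start_mem_support)⟩) P, by simp [h₁], by simp [h₂]⟩

lemma exists_route_from_x (h : IsDetour G a s t G' x y z) {q : V}
    (P : G'.Walk (Sum.inr x) (Sum.inl q)) (hP : P.IsPath) (ha : Sum.inl a ∉ P.support) :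
    (∃ (R : G'.Walk (Sum.inl s) (Sum.inl q)) (Q : Set (Sym2 (V ⊕ Fin 3))), IsRoute a s x y z Q ∧
      R.IsPath ∧ insert s(Sum.inl a, Sum.inr x) {e | e ∈ P.edges} = Q ∪ {e | e ∈ R.edges} ∧
      R.support ⊆ P.support ∧ ∃ j, Sum.inr j ∉ R.support) ∨
    (∃ (R : G'.Walk (Sum.inl t) (Sum.inl q)) (Q : Set (Sym2 (V ⊕ Fin 3))), IsRoute a t y x z Q ∧
      R.IsPath ∧ insert s(Sum.inl a, Sum.inr x) {e | e ∈ P.edges} = Q ∪ {e | e ∈ R.edges} ∧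
      R.support ⊆ P.support ∧ ∃ j, Sum.inr j ∉ R.support) := by
  have hnd := hP.support_nodup
  obtain ⟨R, hR, he, hs⟩ | ⟨R, hR, he, hs⟩ := h.exists_leaving_x P hP ha
  · refine Or.inl ⟨R, _, Or.inl rfl, hR, ?_, by simp [hs], x, ?_⟩
    · rw [he]
      ext e
      simp [Sym2.eq_swap (a := Sum.inr x), or_assoc]
    · rw [hs] at hnd
      exact (List.nodup_cons.1 hnd).1
  · refine Or.inr ⟨R, _, Or.inr (Or.inr rfl), hR, ?_, ?_, x, ?_⟩
    · rw [he]
      ext e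
      simp [Sym2.eq_swap (a := Sum.inr y) (b := Sum.inl t), Sym2.eq_swap (a := Sum.inr z),
        or_assoc]
    · rw [hs]
      intro c hc
      simp [hc]
    · rw [hs] at hnd
      intro hx
      exact (List.nodup_cons.1 hnd).1 (by simp [hx])

lemma exists_route_from_z (h : IsDetour G a s t G' x y z) {q : V}
    (hadj : G'.Adj (Sum.inr z) (Sum.inr x))
    (P : G'.Walk (Sum.inr x) (Sum.inl q)) (hP : P.IsPath) (ha : Sum.inl a ∉ P.support)
    (hz : Sum.inr z ∉ P.support) :
    ∃ (R : G'.Walk (Sum.inl s) (Sum.inl q)) (Q : Set (Sym2 (V ⊕ Fin 3))), IsRoute a s x y z Q ∧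
      R.IsPath ∧ insert s(Sum.inl a, Sum.inr z) {e | e ∈ (Walk.cons hadj P).edges} =
        Q ∪ {e | e ∈ R.edges} ∧
      R.support ⊆ P.support ∧ ∃ j, Sum.inr j ∉ R.support := by
  obtain ⟨R, hR, he, hs⟩ | ⟨R, hR, he, hs⟩ := h.exists_leaving_x P hP ha
  · refine ⟨R, _, Or.inr (Or.inl rfl), hR, ?_, by simp [hs], z, ?_⟩
    · rw [Walk.edges_cons, he]
      ext e
      simp [Sym2.eq_swap (a := Sum.inr x) (b := Sum.inl s), Sym2.eq_swap (a := Sum.inr z),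
        or_assoc]
    · exact fun hz' => hz (by simp [hs, hz'])
  · exact absurd (by simp [hs]) hz

/-- A nontrivial path from `a` first follows a route to `s` or to `t`, and then never meets the
gadget again. -/
lemma exists_route (h : IsDetour G a s t G' x y z) {q : V} (P : G'.Walk (Sum.inl a) (Sum.inl q))
    (hP : P.IsPath) (hq : a ≠ q) :
    (∃ (R : G'.Walk (Sum.inl s) (Sum.inl q)) (Q : Set (Sym2 (V ⊕ Fin 3))), IsRoute a s x y z Q ∧
      R.IsPath ∧ {e | e ∈ P.edges} = Q ∪ {e | e ∈ R.edges} ∧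
      Sum.inl a ∉ R.support ∧ R.support ⊆ P.support ∧ ∀ j, Sum.inr j ∉ R.support) ∨
    (∃ (R : G'.Walk (Sum.inl t) (Sum.inl q)) (Q : Set (Sym2 (V ⊕ Fin 3))), IsRoute a t y x z Q ∧
      R.IsPath ∧ {e | e ∈ P.edges} = Q ∪ {e | e ∈ R.edges} ∧
      Sum.inl a ∉ R.support ∧ R.support ⊆ P.support ∧ ∀ j, Sum.inr j ∉ R.support) := by
  rcases P with _ | ⟨hadj, P⟩
  · exact absurd rfl hq
  rename_i c
  rw [Walk.cons_isPath_iff] at hP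
  obtain ⟨hP, ha⟩ := hP
  have hset : {e | e ∈ (Walk.cons hadj P).edges} = insert s(Sum.inl a, c) {e | e ∈ P.edges} := by
    ext e; simp
  rw [hset, Walk.support_cons]
  have key : ∀ {r : V} {R : G'.Walk (Sum.inl r) (Sum.inl q)}, R.IsPath →
      R.support ⊆ P.support → (∃ j, Sum.inr j ∉ R.support) →
      Sum.inl a ∉ R.support ∧ R.support ⊆ Sum.inl a :: P.support ∧
        ∀ j, Sum.inr j ∉ R.support := by
    rintro r R hR hs ⟨j, hj⟩
    refine ⟨fun h => ha (hs h), fun c hc => List.mem_cons_of_mem _ (hs hc), ?_⟩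
    exact (h.inr_notMem_or_mem R hR (fun h => ha (hs h)) rfl rfl).resolve_right
      fun h => hj (h j)
  rcases c with c | j
  · exact absurd rfl ((h.adj_inl _ _).1 hadj).2.1
  obtain rfl | rfl | rfl := h.eq_or_eq_or_eq j
  · exact (h.exists_route_from_x P hP ha).imp
      (fun ⟨R, Q, hQ, hR, he, hs, hj⟩ => ⟨R, Q, hQ, hR, he, key hR hs hj⟩)
      (fun ⟨R, Q, hQ, hR, he, hs, hj⟩ => ⟨R, Q, hQ, hR, he, key hR hs hj⟩)
  · exact (h.symm.exists_route_from_x P hP ha).symm.imp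
      (fun ⟨R, Q, hQ, hR, he, hs, hj⟩ => ⟨R, Q, hQ, hR, he, key hR hs hj⟩)
      (fun ⟨R, Q, hQ, hR, he, hs, hj⟩ => ⟨R, Q, hQ, hR, he, key hR hs hj⟩)
  rcases P with _ | ⟨hadj₂, P⟩
  rename_i c
  rw [Walk.cons_isPath_iff] at hP
  have ha' : Sum.inl a ∉ P.support := fun h => ha (by simp [h])
  rcases c with c | j
  · obtain rfl := (h.adj_z c).1 hadj₂
    exact absurd (by simp) ha
  obtain rfl | rfl | rfl := h.eq_or_eq_or_eq j
  · obtain ⟨R, Q, hQ, hR, he, hs, hj⟩ := h.exists_route_from_z hadj₂ P hP.1 ha' hP.2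
    exact Or.inl ⟨R, Q, hQ, hR, he, key hR (fun c hc => by simp [hs hc]) hj⟩
  · obtain ⟨R, Q, hQ, hR, he, hs, hj⟩ := h.symm.exists_route_from_z hadj₂ P hP.1 ha' hP.2
    exact Or.inr ⟨R, Q, hQ, hR, he, key hR (fun c hc => by simp [hs hc]) hj⟩
  · exact absurd rfl hadj₂.ne

/-- The edge sets `q` of `G` and `Q` of `G'` describe corresponding ways to leave `a`. -/
def Corr (a s t : V) (x y z : Fin 3) (q : Set (Sym2 V)) (Q : Set (Sym2 (V ⊕ Fin 3))) : Prop :=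
  (q = {s(s, a)} ∧ IsRoute a s x y z Q) ∨ (q = {s(t, a)} ∧ IsRoute a t y x z Q)

lemma contract_path_of_start (h : IsDetour G a s t G' x y z) {q : V}
    (P : G'.Walk (Sum.inl a) (Sum.inl q)) (hP : P.IsPath) (hq : a ≠ q) :
    ∃ (R : G.Walk a q) (F : Set (Sym2 V)) (q : Set (Sym2 V)) (Q : Set (Sym2 (V ⊕ Fin 3))),
      R.IsPath ∧ (∀ c ∈ R.support, Sum.inl c ∈ P.support) ∧ (∀ e ∈ F, a ∉ e) ∧
      {e | e ∈ R.edges} = F ∪ q ∧ {e | e ∈ P.edges} = Sym2.map Sum.inl '' F ∪ Q ∧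
      Corr a s t x y z q Q := by
  have key : ∀ {r : V} {Q} (R : G'.Walk (Sum.inl r) (Sum.inl q)), R.IsPath → G.Adj a r →
      {e | e ∈ P.edges} = Q ∪ {e | e ∈ R.edges} → Sum.inl a ∉ R.support →
      R.support ⊆ P.support → (∀ j, Sum.inr j ∉ R.support) →
      ∃ (R' : G.Walk a q) (F : Set (Sym2 V)),
      R'.IsPath ∧ (∀ c ∈ R'.support, Sum.inl c ∈ P.support) ∧ (∀ e ∈ F, a ∉ e) ∧
      {e | e ∈ R'.edges} = F ∪ {s(r, a)} ∧ {e | e ∈ P.edges} = Sym2.map Sum.inl '' F ∪ Q := by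
    intro r Q R hR hadj he ha hs hr
    obtain ⟨R', he', hs'⟩ := h.descend R hr rfl rfl
    have hmem : ∀ c, Sum.inl c ∈ R.support ↔ c ∈ R'.support := by simp [hs']
    refine ⟨Walk.cons hadj R', {e | e ∈ R'.edges}, ?_, ?_, ?_, ?_, ?_⟩
    · rw [Walk.cons_isPath_iff, Walk.isPath_def, ← hmem]
      refine ⟨?_, ha⟩
      have := hR.support_nodup
      rw [hs'] at this
      exact this.of_map
    · intro c hc
      rw [Walk.support_cons, List.mem_cons] at hc
      obtain rfl | hc := hc
      · exact P.start_mem_support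
      · exact hs ((hmem c).2 hc)
    · intro e he hae
      exact ha ((hmem a).2 (R'.mem_support_of_mem_edges he hae))
    · ext e
      simp [Sym2.eq_swap (a := a)]
    · rw [he, he', Set.union_comm]
      congr 1
      ext e
      simp
  obtain ⟨R, Q, hQ, hR, he, ha, hs, hr⟩ | ⟨R, Q, hQ, hR, he, ha, hs, hr⟩ := h.exists_route P hP hq
  · obtain ⟨R', F, h₁, h₂, h₃, h₄, h₅⟩ := key R hR ((h.adj_iff s).2 (Or.inl rfl)) he ha hs hr
    exact ⟨R', F, _, Q, h₁, h₂, h₃, h₄, h₅, Or.inl ⟨rfl, hQ⟩⟩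
  · obtain ⟨R', F, h₁, h₂, h₃, h₄, h₅⟩ := key R hR ((h.adj_iff t).2 (Or.inr rfl)) he ha hs hr
    exact ⟨R', F, _, Q, h₁, h₂, h₃, h₄, h₅, Or.inr ⟨rfl, hQ⟩⟩

lemma contract_path (h : IsDetour G a s t G' x y z) {p q : V}
    (P : G'.Walk (Sum.inl p) (Sum.inl q)) (hP : P.IsPath) (hpq : p ≠ q)
    (ha : Sum.inl a ∈ P.support → p = a ∨ q = a)
    (hr : Sum.inl a ∉ P.support → ∀ j, Sum.inr j ∉ P.support) :
    ∃ (R : G.Walk p q) (F : Set (Sym2 V)) (q : Set (Sym2 V)) (Q : Set (Sym2 (V ⊕ Fin 3))),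
      R.IsPath ∧ (∀ c ∈ R.support, Sum.inl c ∈ P.support) ∧ (∀ e ∈ F, a ∉ e) ∧
      {e | e ∈ R.edges} = F ∪ q ∧ {e | e ∈ P.edges} = Sym2.map Sum.inl '' F ∪ Q ∧
      (Sum.inl a ∈ P.support → Corr a s t x y z q Q) ∧
      (Sum.inl a ∉ P.support → q = ∅ ∧ Q = ∅) := by
  by_cases hmem : Sum.inl a ∈ P.support
  · obtain rfl | rfl := ha hmem
    · obtain ⟨R, F, q, Q, h₁, h₂, h₃, h₄, h₅, h₆⟩ := h.contract_path_of_start P hP hpq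
      exact ⟨R, F, q, Q, h₁, h₂, h₃, h₄, h₅, fun _ => h₆, fun h => absurd hmem h⟩
    · obtain ⟨R, F, q, Q, h₁, h₂, h₃, h₄, h₅, h₆⟩ :=
        h.contract_path_of_start P.reverse hP.reverse hpq.symm
      exact ⟨R.reverse, F, q, Q, h₁.reverse, by simpa using h₂, h₃, by simpa using h₄,
        by simpa using h₅, fun _ => h₆, fun h => absurd hmem h⟩
  · obtain ⟨R, he, hs⟩ := h.descend P (hr hmem) rfl rfl
    refine ⟨R, {e | e ∈ R.edges}, ∅, ∅, ?_, ?_, ?_, ?_, ?_, fun h => absurd h hmem,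
      fun _ => ⟨rfl, rfl⟩⟩
    · have := hP.support_nodup
      rw [hs] at this
      exact Walk.IsPath.mk' this.of_map
    · simp [hs]
    · intro e he hae
      exact hmem (by simpa [hs] using R.mem_support_of_mem_edges he hae)
    · simp
    · rw [he]
      ext e
      simp

/-- The way to leave `a` in `G'` given by the short route. -/
def CorrShort (a s t : V) (x y : Fin 3) (q : Set (Sym2 V)) (Q : Set (Sym2 (V ⊕ Fin 3))) : Prop :=
  (q = {s(s, a)} ∧ Q = {s(Sum.inl a, Sum.inr x), s(Sum.inl s, Sum.inr x)}) ∨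
  (q = {s(t, a)} ∧ Q = {s(Sum.inl a, Sum.inr y), s(Sum.inl t, Sum.inr y)})

lemma expand_path_of_start (h : IsDetour G a s t G' x y z) {q : V} (R : G.Walk a q)
    (hR : R.IsPath) (hq : a ≠ q) :
    ∃ (P : G'.Walk (Sum.inl a) (Sum.inl q)) (F : Set (Sym2 V)) (q : Set (Sym2 V))
      (Q : Set (Sym2 (V ⊕ Fin 3))),
      P.IsPath ∧ (∀ c, Sum.inl c ∈ P.support → c ∈ R.support) ∧ (∀ e ∈ F, a ∉ e) ∧
      {e | e ∈ R.edges} = F ∪ q ∧ {e | e ∈ P.edges} = Sym2.map Sum.inl '' F ∪ Q ∧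
      CorrShort a s t x y q Q := by
  rcases R with _ | ⟨hadj, R⟩
  · exact absurd rfl hq
  rename_i c
  rw [Walk.cons_isPath_iff] at hR
  obtain ⟨P, he, hs⟩ := h.lift R hR.2
  have key : ∀ j, G'.Adj (Sum.inr j) (Sum.inl a) → G'.Adj (Sum.inr j) (Sum.inl c) →
      ∃ (P : G'.Walk (Sum.inl a) (Sum.inl q)) (F : Set (Sym2 V)),
      P.IsPath ∧ (∀ b, Sum.inl b ∈ P.support → b ∈ (Walk.cons hadj R).support) ∧
      (∀ e ∈ F, a ∉ e) ∧ {e | e ∈ (Walk.cons hadj R).edges} = F ∪ {s(c, a)} ∧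
      {e | e ∈ P.edges} = Sym2.map Sum.inl '' F ∪
        {s(Sum.inl a, Sum.inr j), s(Sum.inl c, Sum.inr j)} := by
    intro j hja hjc
    refine ⟨Walk.cons hja.symm (Walk.cons hjc P), {e | e ∈ R.edges}, ?_, ?_, ?_, ?_, ?_⟩
    · have hnd := hR.1.support_nodup
      rw [Walk.cons_isPath_iff, Walk.cons_isPath_iff, Walk.isPath_def, hs,
        List.nodup_map_iff Sum.inl_injective]
      exact ⟨⟨hnd, by simp⟩, by simp [hs, hR.2]⟩
    · intro b hb
      simpa [hs, eq_comm] using hb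
    · intro e he hae
      exact hR.2 (R.mem_support_of_mem_edges he hae)
    · ext e
      simp [Sym2.eq_swap (a := a)]
    · ext e
      simp only [Walk.edges_cons, he, List.mem_cons, List.mem_map, Set.mem_ofPred_eq, Set.mem_union,
        Set.mem_image, Set.mem_insert_iff, Set.mem_singleton_iff,
        Sym2.eq_swap (a := Sum.inr j) (b := Sum.inl c)]
      rw [← or_assoc, or_comm]
  obtain rfl | rfl := (h.adj_iff c).1 hadj
  · obtain ⟨P, F, h₁, h₂, h₃, h₄, h₅⟩ := key x ((h.adj_x a).2 (Or.inr rfl))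
      ((h.adj_x c).2 (Or.inl rfl))
    exact ⟨P, F, _, _, h₁, h₂, h₃, h₄, h₅, Or.inl ⟨rfl, rfl⟩⟩
  · obtain ⟨P, F, h₁, h₂, h₃, h₄, h₅⟩ := key y ((h.adj_y a).2 (Or.inr rfl))
      ((h.adj_y c).2 (Or.inl rfl))
    exact ⟨P, F, _, _, h₁, h₂, h₃, h₄, h₅, Or.inr ⟨rfl, rfl⟩⟩

lemma expand_path (h : IsDetour G a s t G' x y z) {p q : V} (R : G.Walk p q) (hR : R.IsPath)
    (hpq : p ≠ q) (ha : a ∈ R.support → p = a ∨ q = a) :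
    ∃ (P : G'.Walk (Sum.inl p) (Sum.inl q)) (F : Set (Sym2 V)) (q : Set (Sym2 V))
      (Q : Set (Sym2 (V ⊕ Fin 3))),
      P.IsPath ∧ (∀ c, Sum.inl c ∈ P.support → c ∈ R.support) ∧
      (∀ j, Sum.inr j ∈ P.support → a ∈ R.support) ∧ (∀ e ∈ F, a ∉ e) ∧
      {e | e ∈ R.edges} = F ∪ q ∧ {e | e ∈ P.edges} = Sym2.map Sum.inl '' F ∪ Q ∧
      (a ∈ R.support → CorrShort a s t x y q Q) ∧
      (a ∉ R.support → q = ∅ ∧ Q = ∅) := by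
  by_cases hmem : a ∈ R.support
  · obtain rfl | rfl := ha hmem
    · obtain ⟨P, F, q, Q, h₁, h₂, h₃, h₄, h₅, h₆⟩ := h.expand_path_of_start R hR hpq
      exact ⟨P, F, q, Q, h₁, h₂, fun _ _ => hmem, h₃, h₄, h₅, fun _ => h₆,
        fun h => absurd hmem h⟩
    · obtain ⟨P, F, q, Q, h₁, h₂, h₃, h₄, h₅, h₆⟩ :=
        h.expand_path_of_start R.reverse hR.reverse hpq.symm
      exact ⟨P.reverse, F, q, Q, h₁.reverse, by simpa using h₂, fun _ _ => hmem, h₃,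
        by simpa using h₄, by simpa using h₅, fun _ => h₆, fun h => absurd hmem h⟩
  · obtain ⟨P, he, hs⟩ := h.lift R hmem
    refine ⟨P, {e | e ∈ R.edges}, ∅, ∅, ?_, ?_, ?_, ?_, ?_, ?_, fun h => absurd h hmem,
      fun _ => ⟨rfl, rfl⟩⟩
    · rw [Walk.isPath_def, hs, List.nodup_map_iff Sum.inl_injective]
      exact hR.support_nodup
    · simp [hs]
    · simp [hs]
    · intro e he hae
      exact hmem (R.mem_support_of_mem_edges he hae)
    · simp
    · rw [he]
      ext e
      simp

section Solution

variable [DecidableEq V] {A B : Finset V}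

lemma contract_solution (h : IsDetour G a s t G' x y z) (hd : Disjoint A B) (hA : Even A.card)
    (hB : Even B.card) (ha : a ∈ A ∪ B) {E : Set (Sym2 (V ⊕ Fin 3))}
    (hE : IsSolution G' (A.image Sum.inl) (B.image Sum.inl) E) :
    ∃ (F q : Set (Sym2 V)) (Q : Set (Sym2 (V ⊕ Fin 3))), (∀ e ∈ F, a ∉ e) ∧
      IsSolution G A B (F ∪ q) ∧ E = Sym2.map Sum.inl '' F ∪ Q ∧ Corr a s t x y z q Q := by
  obtain ⟨k, f, hf⟩ := hE
  have hcA := Finset.card_image_of_injective A (Sum.inl_injective (β := Fin 3))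
  have hcB := Finset.card_image_of_injective B (Sum.inl_injective (β := Fin 3))
  have hne := hf.fst_ne_snd ((Finset.disjoint_image Sum.inl_injective).2 hd)
    (hcA ▸ hA) (hcB ▸ hB)
  have ha' : Sum.inl a ∈ A.image (Sum.inl (β := Fin 3)) ∪ B.image Sum.inl := by
    rw [← Finset.image_union]
    exact Finset.mem_image_of_mem _ ha
  have hmem := fun i => hf.eq_of_mem_support (i := i) ha'
  obtain ⟨i₀, hi₀⟩ := hf.exists_mem_support ha'
  obtain ⟨hk, hpath, hend, hdis, hcov, rfl⟩ := hf
  have hends : ∀ i, ∃ p q, (f i).1 = Sum.inl p ∧ (f i).2.1 = Sum.inl q ∧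
      (p ∈ A ∧ q ∈ A ∨ p ∈ B ∧ q ∈ B) := by
    intro i
    simp only [Finset.mem_image] at hend
    obtain ⟨⟨p, hp, hp'⟩, ⟨q, hq, hq'⟩⟩ | ⟨⟨p, hp, hp'⟩, ⟨q, hq, hq'⟩⟩ := hend i
    · exact ⟨p, q, hp'.symm, hq'.symm, Or.inl ⟨hp, hq⟩⟩
    · exact ⟨p, q, hp'.symm, hq'.symm, Or.inr ⟨hp, hq⟩⟩
  choose p q hp hq hpq using hends
  have huniq : ∀ i, Sum.inl a ∈ (f i).2.2.support → i = i₀ := fun i hi =>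
    by_contra fun hne => hdis i i₀ hne _ hi hi₀
  have hex₀ : ∃ j, Sum.inr j ∈ (f i₀).2.2.support := by
    by_contra! hcon
    have hnil : ¬ (f i₀).2.2.Nil := fun hn => hne i₀ hn.eq
    have hnn : ∀ {p' q' : V ⊕ Fin 3} (P : G'.Walk p' q'), ¬ P.Nil → p' = Sum.inl a →
        (∃ j, Sum.inr j ∈ P.support) := by
      rintro p' q' P hn rfl
      rcases P with _ | ⟨hadj, P⟩
      · exact absurd Walk.nil_nil hn
      rename_i c
      rcases c with c | j
      · exact absurd rfl ((h.adj_inl _ _).1 hadj).2.1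
      · exact ⟨j, by simp⟩
    obtain h₀ | h₀ := hmem i₀ hi₀
    · obtain ⟨j, hj⟩ := hnn _ hnil h₀
      exact hcon j hj
    · obtain ⟨j, hj⟩ := hnn (f i₀).2.2.reverse (by simpa using hnil) h₀
      exact hcon j (by simpa using hj)
  have hinr : ∀ i, Sum.inl a ∉ (f i).2.2.support → ∀ j, Sum.inr j ∉ (f i).2.2.support := by
    intro i hi
    refine (h.inr_notMem_or_mem _ (hpath i) hi (by simp [hp]) (by simp [hq])).resolve_right ?_
    intro hall
    obtain ⟨j, hj⟩ := hex₀
    exact hdis i i₀ (by rintro rfl; exact hi hi₀) _ (hall j) hj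
  have key := fun i => h.contract_path ((f i).2.2.copy (hp i) (hq i)) (by simpa using hpath i)
    (fun e => hne i ((hp i).trans ((congrArg _ e).trans (hq i).symm)))
    (fun hi => by simpa [hp, hq] using hmem i (by simpa using hi))
    (by simpa using hinr i)
  simp only [Walk.support_copy, Walk.edges_copy] at key
  choose R F e Q hR hs hF hRe hfe hin hout using key
  have hQ := Set.iUnion_eq_of_forall_ne Q i₀ fun i hi => (hout i (mt (huniq i) hi)).2
  have he := Set.iUnion_eq_of_forall_ne e i₀ fun i hi => (hout i (mt (huniq i) hi)).1
  refine ⟨⋃ i, F i, e i₀, Q i₀, ?_, ⟨k, fun i => ⟨p i, q i, R i⟩, ?_, hR, hpq, ?_, ?_, ?_⟩, ?_,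
    hin i₀ hi₀⟩
  · simpa using fun e i => hF i e
  · rw [hk, hcA, hcB]
  · exact fun i j hij c hc hc' => hdis i j hij _ (hs i c hc) (hs j c hc')
  · intro c hc
    obtain ⟨i, hi⟩ := hcov (Sum.inl c) (by
      rw [← Finset.image_union]
      exact Finset.mem_image_of_mem _ hc)
    exact ⟨i, by simpa [hp, hq] using hi⟩
  · simp only [hRe]
    rw [Set.iUnion_union_distrib, he]
  · simp only [hfe]
    rw [Set.iUnion_union_distrib, hQ, Set.image_iUnion]

lemma expand_solution (h : IsDetour G a s t G' x y z) (hd : Disjoint A B) (hA : Even A.card)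
    (hB : Even B.card) (ha : a ∈ A ∪ B) {E : Set (Sym2 V)} (hE : IsSolution G A B E) :
    ∃ (F q : Set (Sym2 V)) (Q : Set (Sym2 (V ⊕ Fin 3))), (∀ e ∈ F, a ∉ e) ∧
      E = F ∪ q ∧
      IsSolution G' (A.image Sum.inl) (B.image Sum.inl) (Sym2.map Sum.inl '' F ∪ Q) ∧
      CorrShort a s t x y q Q := by
  obtain ⟨k, f, hf⟩ := hE
  have hcA := Finset.card_image_of_injective A (Sum.inl_injective (β := Fin 3))
  have hcB := Finset.card_image_of_injective B (Sum.inl_injective (β := Fin 3))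
  have hne := hf.fst_ne_snd hd hA hB
  have hmem := fun i => hf.eq_of_mem_support (i := i) ha
  obtain ⟨i₀, hi₀⟩ := hf.exists_mem_support ha
  obtain ⟨hk, hpath, hend, hdis, hcov, rfl⟩ := hf
  have huniq : ∀ i, a ∈ (f i).2.2.support → i = i₀ := fun i hi =>
    by_contra fun hne => hdis i i₀ hne _ hi hi₀
  have key := fun i => h.expand_path (f i).2.2 (hpath i) (hne i) (hmem i)
  choose P F e Q hP hinl hinr hF hRe hfe hin hout using key
  have hQ := Set.iUnion_eq_of_forall_ne Q i₀ fun i hi => (hout i (mt (huniq i) hi)).2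
  have he := Set.iUnion_eq_of_forall_ne e i₀ fun i hi => (hout i (mt (huniq i) hi)).1
  refine ⟨⋃ i, F i, e i₀, Q i₀, ?_, ?_,
    ⟨k, fun i => ⟨Sum.inl (f i).1, Sum.inl (f i).2.1, P i⟩, ?_, hP, ?_, ?_, ?_, ?_⟩, hin i₀ hi₀⟩
  · simpa using fun e i => hF i e
  · simp only [hRe]
    rw [Set.iUnion_union_distrib, he]
  · rw [hk, hcA, hcB]
  · simpa using hend
  · rintro i j hij (c | c) hc hc'
    · exact hdis i j hij _ (hinl i c hc) (hinl j c hc')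
    · exact hdis i j hij _ (hinr i c hc) (hinr j c hc')
  · intro c hc
    rw [← Finset.image_union] at hc
    obtain ⟨b, hb, rfl⟩ := Finset.mem_image.1 hc
    simpa using hcov b hb
  · simp only [hfe]
    rw [Set.iUnion_union_distrib, hQ, Set.image_iUnion]

end Solution

lemma CorrShort.corr {q : Set (Sym2 V)} {Q : Set (Sym2 (V ⊕ Fin 3))}
    (hc : CorrShort a s t x y q Q) : Corr a s t x y z q Q :=
  hc.imp (And.imp_right Or.inl) (And.imp_right Or.inl)

lemma _root_.IsRoute.exists_inr_mem {Q : Set (Sym2 (V ⊕ Fin 3))} (hQ : IsRoute a s x y z Q) :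
    ∀ e ∈ Q, ∃ j, Sum.inr j ∈ e := by
  obtain rfl | rfl | rfl := hQ <;> simp

lemma inr_notMem_of_mem_image {F : Set (Sym2 V)} {e : Sym2 (V ⊕ Fin 3)}
    (he : e ∈ Sym2.map Sum.inl '' F) (j : Fin 3) : Sum.inr j ∉ e := by
  obtain ⟨e, -, rfl⟩ := he
  simp [Sym2.mem_map]

/-- The edge set of `G` obtained by contracting an edge set of `G'`. -/
def contractSet (a s t : V) (x y : Fin 3) (E : Set (Sym2 (V ⊕ Fin 3))) : Set (Sym2 V) :=
  {e | a ∉ e ∧ e.map Sum.inl ∈ E} ∪ {e | e = s(s, a) ∧ s(Sum.inl s, Sum.inr x) ∈ E} ∪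
    {e | e = s(t, a) ∧ s(Sum.inl t, Sum.inr y) ∈ E}

/-- The edge set of `G'` obtained by rerouting an edge set of `G` along the short routes. -/
def expandSet (a s t : V) (x y : Fin 3) (E : Set (Sym2 V)) : Set (Sym2 (V ⊕ Fin 3)) :=
  Sym2.map Sum.inl '' {e | e ∈ E ∧ a ∉ e} ∪
    {e | s(s, a) ∈ E ∧ (e = s(Sum.inl a, Sum.inr x) ∨ e = s(Sum.inl s, Sum.inr x))} ∪
    {e | s(t, a) ∈ E ∧ (e = s(Sum.inl a, Sum.inr y) ∨ e = s(Sum.inl t, Sum.inr y))}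

lemma contractSet_symm (E : Set (Sym2 (V ⊕ Fin 3))) :
    contractSet a s t x y E = contractSet a t s y x E :=
  Set.union_right_comm ..

lemma expandSet_symm (E : Set (Sym2 V)) : expandSet a s t x y E = expandSet a t s y x E :=
  Set.union_right_comm ..

lemma contractSet_eq (h : IsDetour G a s t G' x y z) (hst : s ≠ t) {F q : Set (Sym2 V)}
    {Q : Set (Sym2 (V ⊕ Fin 3))} (hF : ∀ e ∈ F, a ∉ e) (hc : Corr a s t x y z q Q) :
    contractSet a s t x y (Sym2.map Sum.inl '' F ∪ Q) = F ∪ q := by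
  have key : ∀ {s t x y}, IsDetour G a s t G' x y z → s ≠ t → IsRoute a s x y z Q →
      contractSet a s t x y (Sym2.map Sum.inl '' F ∪ Q) = F ∪ {s(s, a)} := by
    intro s t x y h hst hQ
    have hold : ∀ e : Sym2 V, e.map Sum.inl ∈ Sym2.map Sum.inl '' F ∪ Q ↔ e ∈ F := by
      intro e
      rw [Set.mem_union, (Sym2.map.injective Sum.inl_injective).mem_set_image, or_iff_left]
      intro he
      obtain ⟨j, hj⟩ := hQ.exists_inr_mem _ he
      simp [Sym2.mem_map] at hj
    have hnew : ∀ (c : V) (j : Fin 3),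
        s(Sum.inl c, Sum.inr j) ∈ Sym2.map Sum.inl '' F ∪ Q ↔ s(Sum.inl c, Sum.inr j) ∈ Q := by
      intro c j
      rw [Set.mem_union, or_iff_right]
      exact fun he => inr_notMem_of_mem_image he j (by simp)
    have hs : s(Sum.inl s, Sum.inr x) ∈ Q := by
      obtain rfl | rfl | rfl := hQ <;> simp
    have ht : s(Sum.inl t, Sum.inr y) ∉ Q := by
      have := h.symm.s_ne
      have := h.hxy.symm
      have := h.hyz
      obtain rfl | rfl | rfl := hQ <;> simp [*]
    ext e
    simp only [contractSet, Set.mem_union, Set.mem_ofPred_eq, hold, hnew, hs, ht, and_true,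
      and_false, or_false, Set.mem_singleton_iff]
    exact or_congr_left (and_iff_right_of_imp (hF e))
  obtain ⟨rfl, hQ⟩ | ⟨rfl, hQ⟩ := hc
  · exact key h hst hQ
  · rw [contractSet_symm]
    exact key h.symm hst.symm hQ

lemma expandSet_eq (hst : s ≠ t) {F q : Set (Sym2 V)}
    {Q : Set (Sym2 (V ⊕ Fin 3))} (hF : ∀ e ∈ F, a ∉ e) (hc : CorrShort a s t x y q Q) :
    expandSet a s t x y (F ∪ q) = Sym2.map Sum.inl '' F ∪ Q := by
  have key : ∀ {s t x y}, s ≠ t → expandSet a s t x y (F ∪ {s(s, a)}) = Sym2.map Sum.inl '' F ∪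
      {s(Sum.inl a, Sum.inr x), s(Sum.inl s, Sum.inr x)} := by
    intro s t x y hst
    have hs : s(s, a) ∈ F ∪ {s(s, a)} := Or.inr rfl
    have ht : s(t, a) ∉ F ∪ {s(s, a)} := by
      rintro (ht | ht)
      · exact hF _ ht (by simp)
      · exact hst (Sym2.congr_left.1 ht).symm
    have hold : {e | e ∈ F ∪ {s(s, a)} ∧ a ∉ e} = F := by
      ext e
      constructor
      · rintro ⟨he | rfl, ha⟩
        · exact he
        · simp at ha
      · exact fun he => ⟨Or.inl he, hF e he⟩
    rw [expandSet, hold]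
    simp only [hs, ht, true_and, false_and, Set.ofPred_false, Set.union_empty]
    rfl
  obtain ⟨rfl, rfl⟩ | ⟨rfl, rfl⟩ := hc
  · exact key hst
  · rw [expandSet_symm]
    exact key hst.symm

lemma lengthOf_union_route [Finite V] {ℓ : Sym2 V → ℕ} {ℓ' : Sym2 (V ⊕ Fin 3) → ℕ}
    (hold : ∀ e : Sym2 V, ℓ' (e.map Sum.inl) = ℓ e) {F : Set (Sym2 V)}
    {Q : Set (Sym2 (V ⊕ Fin 3))} (hF : ∀ e ∈ F, a ∉ e) (hQ : IsRoute a s x y z Q) :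
    lengthOf ℓ' (Sym2.map Sum.inl '' F ∪ Q) + ℓ s(s, a) =
      lengthOf ℓ (F ∪ {s(s, a)}) + lengthOf ℓ' Q := by
  have hdisj : Disjoint (Sym2.map Sum.inl '' F) Q := by
    rw [Set.disjoint_left]
    intro e he heQ
    obtain ⟨j, hj⟩ := hQ.exists_inr_mem e heQ
    exact inr_notMem_of_mem_image he j hj
  have hdisj' : Disjoint F {s(s, a)} := by
    rw [Set.disjoint_singleton_right]
    exact fun he => hF _ he (by simp)
  simp only [lengthOf]
  rw [finsum_mem_union hdisj (Set.toFinite _) (Set.toFinite _),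
    finsum_mem_union hdisj' (Set.toFinite _) (Set.toFinite _), finsum_mem_singleton,
    finsum_mem_image (Sym2.map.injective Sum.inl_injective).injOn]
  simp only [hold]
  ring

lemma lengthOf_short (h : IsDetour G a s t G' x y z) {ℓ' : Sym2 (V ⊕ Fin 3) → ℕ}
    (hax : ℓ' s(Sum.inl a, Sum.inr x) = 1) :
    lengthOf ℓ' {s(Sum.inl a, Sum.inr x), s(Sum.inl s, Sum.inr x)} =
      ℓ' s(Sum.inl s, Sum.inr x) + 1 := by
  have := h.s_ne.symm
  rw [lengthOf, finsum_mem_pair (by simp [*]), hax, add_comm]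

lemma lengthOf_route (h : IsDetour G a s t G' x y z) {ℓ' : Sym2 (V ⊕ Fin 3) → ℕ}
    (hay : ℓ' s(Sum.inl a, Sum.inr y) = 1) (haz : ℓ' s(Sum.inl a, Sum.inr z) = 1)
    (hxz : ℓ' s(Sum.inr x, Sum.inr z) = 1) (hyz : ℓ' s(Sum.inr y, Sum.inr z) = 1)
    {Q : Set (Sym2 (V ⊕ Fin 3))} (hQ : IsRoute a s x y z Q) :
    Q = {s(Sum.inl a, Sum.inr x), s(Sum.inl s, Sum.inr x)} ∨
      ℓ' s(Sum.inl s, Sum.inr x) + 1 < lengthOf ℓ' Q := by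
  have := h.s_ne.symm
  have := h.hxy
  have := h.hxy.symm
  have := h.hxz
  have := h.hyz
  refine hQ.imp_right ?_
  rw [lengthOf]
  rintro (rfl | rfl)
  · rw [finsum_mem_insert _ (by simp [*]) (Set.toFinite _), finsum_mem_pair (by simp [*]),
      haz, hxz]
    omega
  · rw [finsum_mem_insert _ (by simp [*]) (Set.toFinite _),
      finsum_mem_insert _ (by simp [*]) (Set.toFinite _), finsum_mem_pair (by simp [*]),
      hay, hyz, hxz]
    omega

lemma lengthOf_corrShort [Finite V] (h : IsDetour G a s t G' x y z) {ℓ : Sym2 V → ℕ}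
    {ℓ' : Sym2 (V ⊕ Fin 3) → ℕ} (hold : ∀ e : Sym2 V, ℓ' (e.map Sum.inl) = ℓ e)
    (hs : ℓ' s(Sum.inl s, Sum.inr x) = ℓ s(s, a)) (ht : ℓ' s(Sum.inl t, Sum.inr y) = ℓ s(t, a))
    (hax : ℓ' s(Sum.inl a, Sum.inr x) = 1) (hay : ℓ' s(Sum.inl a, Sum.inr y) = 1)
    {F q : Set (Sym2 V)} {Q : Set (Sym2 (V ⊕ Fin 3))}
    (hF : ∀ e ∈ F, a ∉ e) (hc : CorrShort a s t x y q Q) :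
    lengthOf ℓ' (Sym2.map Sum.inl '' F ∪ Q) = lengthOf ℓ (F ∪ q) + 1 := by
  obtain ⟨rfl, rfl⟩ | ⟨rfl, rfl⟩ := hc
  · have := lengthOf_union_route (s := s) (x := x) (y := y) (z := z) hold hF (Or.inl rfl)
    have := h.lengthOf_short hax
    omega
  · have := lengthOf_union_route (s := t) (x := y) (y := x) (z := z) hold hF (Or.inl rfl)
    have := h.symm.lengthOf_short hay
    omega

lemma corrShort_or_lt_lengthOf [Finite V] (h : IsDetour G a s t G' x y z) {ℓ : Sym2 V → ℕ}
    {ℓ' : Sym2 (V ⊕ Fin 3) → ℕ} (hold : ∀ e : Sym2 V, ℓ' (e.map Sum.inl) = ℓ e)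
    (hs : ℓ' s(Sum.inl s, Sum.inr x) = ℓ s(s, a)) (ht : ℓ' s(Sum.inl t, Sum.inr y) = ℓ s(t, a))
    (hax : ℓ' s(Sum.inl a, Sum.inr x) = 1) (hay : ℓ' s(Sum.inl a, Sum.inr y) = 1)
    (haz : ℓ' s(Sum.inl a, Sum.inr z) = 1) (hxz : ℓ' s(Sum.inr x, Sum.inr z) = 1)
    (hyz : ℓ' s(Sum.inr y, Sum.inr z) = 1) {F q : Set (Sym2 V)} {Q : Set (Sym2 (V ⊕ Fin 3))}
    (hF : ∀ e ∈ F, a ∉ e) (hc : Corr a s t x y z q Q) :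
    CorrShort a s t x y q Q ∨
      lengthOf ℓ (F ∪ q) + 1 < lengthOf ℓ' (Sym2.map Sum.inl '' F ∪ Q) := by
  obtain ⟨rfl, hQ⟩ | ⟨rfl, hQ⟩ := hc
  · refine (h.lengthOf_route hay haz hxz hyz hQ).imp (fun e => Or.inl ⟨rfl, e⟩) fun hlt => ?_
    have := lengthOf_union_route hold hF hQ
    omega
  · refine (h.symm.lengthOf_route hax haz hyz hxz hQ).imp (fun e => Or.inr ⟨rfl, e⟩)
      fun hlt => ?_
    have := lengthOf_union_route hold hF hQ
    omega

end IsDetour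

lemma lAB_le {V : Type} [DecidableEq V] {G : SimpleGraph V} {A B : Finset V} {ℓ : Sym2 V → ℕ}
    {E : Set (Sym2 V)} (hE : IsSolution G A B E) : lAB G A B ℓ ≤ lengthOf ℓ E :=
  Nat.sInf_le ⟨E, hE, rfl⟩

lemma exists_lengthOf_eq_lAB {V : Type} [DecidableEq V] {G : SimpleGraph V} {A B : Finset V}
    {ℓ : Sym2 V → ℕ} (hex : ∃ E, IsSolution G A B E) :
    ∃ E, IsSolution G A B E ∧ lengthOf ℓ E = lAB G A B ℓ :=
  let ⟨E, hE⟩ := hex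
  Nat.sInf_mem (s := {n | ∃ E, IsSolution G A B E ∧ lengthOf ℓ E = n}) ⟨_, E, hE, rfl⟩

/-!
STATEMENT 17.  Suppose `a ∈ A ∪ B` has degree 2 in `G` with distinct neighbors `u`
and `v`, and a solution to Disjoint `A`,`B`-paths on `G` exists.  Let `G′` be obtained
from `G` by deleting the edges `ua`, `av`, adding three new nonterminal vertices
`u′ = inr 0`, `v′ = inr 1`, `w = inr 2` and the edges `uu′` (length `ℓ(ua)`), `v′v`
(length `ℓ(av)`) and `u′a, u′w, aw, av′, wv′` (length 1).  Then: (i) every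
minimum-length solution on `G′` uses, among the new edges, exactly the two edges of
the path `a,u′,u` or exactly the two edges of the path `a,v′,v`, and in particular no
minimum-length solution uses the vertex `w`; (ii) `ℓ_{A,B}(G′) = ℓ_{A,B}(G) + 1`;
(iii) the minimum-length solutions of `G′` are in bijection with those of `G`, so
`S_{A,B}(G′) = S_{A,B}(G)`.
-/
theorem stmt17 {V : Type} [Fintype V] [DecidableEq V]
    (G : SimpleGraph V) (A B : Finset V) (ℓ : Sym2 V → ℕ)
    (hdisj : Disjoint A B) (hA : Even A.card) (hB : Even B.card)
    (hℓ : ∀ e ∈ G.edgeSet, 1 ≤ ℓ e)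
    (a u v : V) (ha : a ∈ A ∪ B) (hnb : G.neighborSet a = {u, v}) (huv : u ≠ v)
    (hex : ∃ E', IsSolution G A B E')
    (G' : SimpleGraph (V ⊕ Fin 3))
    (hG' : G' = SimpleGraph.fromRel (fun p q =>
      (∃ p₀ q₀ : V, p = Sum.inl p₀ ∧ q = Sum.inl q₀ ∧ G.Adj p₀ q₀ ∧
        s(p₀, q₀) ≠ s(u, a) ∧ s(p₀, q₀) ≠ s(a, v)) ∨
      (p = Sum.inl u ∧ q = Sum.inr 0) ∨ (p = Sum.inl v ∧ q = Sum.inr 1) ∨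
      (p = Sum.inl a ∧ q = Sum.inr 0) ∨ (p = Sum.inl a ∧ q = Sum.inr 1) ∨
      (p = Sum.inl a ∧ q = Sum.inr 2) ∨
      (p = Sum.inr 0 ∧ q = Sum.inr 2) ∨ (p = Sum.inr 2 ∧ q = Sum.inr 1)))
    (ℓ' : Sym2 (V ⊕ Fin 3) → ℕ)
    (hℓ'old : ∀ e : Sym2 V, ℓ' (e.map Sum.inl) = ℓ e)
    (hℓ'u : ℓ' s((Sum.inl u : V ⊕ Fin 3), Sum.inr 0) = ℓ s(u, a))
    (hℓ'v : ℓ' s((Sum.inl v : V ⊕ Fin 3), Sum.inr 1) = ℓ s(a, v))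
    (hℓ'1 : ℓ' s((Sum.inl a : V ⊕ Fin 3), Sum.inr 0) = 1 ∧
            ℓ' s((Sum.inl a : V ⊕ Fin 3), Sum.inr 1) = 1 ∧
            ℓ' s((Sum.inl a : V ⊕ Fin 3), Sum.inr 2) = 1 ∧
            ℓ' s((Sum.inr 0 : V ⊕ Fin 3), Sum.inr 2) = 1 ∧
            ℓ' s((Sum.inr 2 : V ⊕ Fin 3), Sum.inr 1) = 1)
    (A' B' : Finset (V ⊕ Fin 3))
    (hA' : A' = A.image Sum.inl) (hB' : B' = B.image Sum.inl)
    (newEdges : Set (Sym2 (V ⊕ Fin 3)))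
    (hnew : newEdges = {s((Sum.inl u : V ⊕ Fin 3), Sum.inr 0),
      s((Sum.inl v : V ⊕ Fin 3), Sum.inr 1), s((Sum.inl a : V ⊕ Fin 3), Sum.inr 0),
      s((Sum.inl a : V ⊕ Fin 3), Sum.inr 1), s((Sum.inl a : V ⊕ Fin 3), Sum.inr 2),
      s((Sum.inr 0 : V ⊕ Fin 3), Sum.inr 2), s((Sum.inr 2 : V ⊕ Fin 3), Sum.inr 1)}) :
    -- (i)
    (∀ E'' : Set (Sym2 (V ⊕ Fin 3)), IsSolution G' A' B' E'' →
      lengthOf ℓ' E'' = lAB G' A' B' ℓ' →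
      ((E'' ∩ newEdges = {s((Sum.inl a : V ⊕ Fin 3), Sum.inr 0),
          s((Sum.inl u : V ⊕ Fin 3), Sum.inr 0)} ∨
        E'' ∩ newEdges = {s((Sum.inl a : V ⊕ Fin 3), Sum.inr 1),
          s((Sum.inl v : V ⊕ Fin 3), Sum.inr 1)}) ∧
       ∀ ε ∈ E'', (Sum.inr 2 : V ⊕ Fin 3) ∉ ε)) ∧
    -- (ii)
    lAB G' A' B' ℓ' = lAB G A B ℓ + 1 ∧
    -- (iii)
    (∃ φ : Set (Sym2 (V ⊕ Fin 3)) → Set (Sym2 V),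
      Set.BijOn φ
        {E'' | IsSolution G' A' B' E'' ∧ lengthOf ℓ' E'' = lAB G' A' B' ℓ'}
        {E' | IsSolution G A B E' ∧ lengthOf ℓ E' = lAB G A B ℓ}) ∧
    nSol G' A' B' ℓ' = nSol G A B ℓ := by
  subst hA' hB' hnew
  have hadj : ∀ p, G.Adj a p ↔ p = u ∨ p = v := fun p => by
    rw [← SimpleGraph.mem_neighborSet, hnb]; rfl
  have h : IsDetour G a u v G' 0 1 2 := by
    subst hG'
    refine ⟨hadj, fun p q => ?_, ?_, ?_, ?_, ?_, ?_, ?_, ?_, ?_, ?_⟩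
    · have hp := hadj p
      have hq := hadj q
      have hne := G.ne_of_adj (a := p) (b := q)
      have hcomm := G.adj_comm p q
      have hcomm' := G.adj_comm p a
      simp only [SimpleGraph.fromRel_adj]
      simp
      grind
    all_goals simp [SimpleGraph.fromRel_adj]
  have hℓv : ℓ' s(Sum.inl v, Sum.inr 1) = ℓ s(v, a) := by rw [hℓ'v, Sym2.eq_swap]
  have hℓyz : ℓ' s(Sum.inr 1, Sum.inr 2) = 1 := by rw [Sym2.eq_swap]; exact hℓ'1.2.2.2.2
  have hlen := fun {F q Q} => h.lengthOf_corrShort (F := F) (q := q) (Q := Q) hℓ'old hℓ'u hℓv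
    hℓ'1.1 hℓ'1.2.1
  have hlt := fun {F q Q} => h.corrShort_or_lt_lengthOf (F := F) (q := q) (Q := Q) hℓ'old hℓ'u hℓv
    hℓ'1.1 hℓ'1.2.1 hℓ'1.2.2.1 hℓ'1.2.2.2.1 hℓyz
  have hcontract : ∀ E, IsSolution G' (A.image Sum.inl) (B.image Sum.inl) E →
      IsSolution G A B (IsDetour.contractSet a u v 0 1 E) ∧
      (lengthOf ℓ' E = lengthOf ℓ (IsDetour.contractSet a u v 0 1 E) + 1 ∧
        IsDetour.expandSet a u v 0 1 (IsDetour.contractSet a u v 0 1 E) = E ∧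
        (∃ F q Q, E = Sym2.map Sum.inl '' F ∪ Q ∧ IsDetour.CorrShort a u v 0 1 q Q) ∨
      lengthOf ℓ (IsDetour.contractSet a u v 0 1 E) + 1 < lengthOf ℓ' E) := by
    intro E hE
    obtain ⟨F, q, Q, hF, hsol, rfl, hc⟩ := h.contract_solution hdisj hA hB ha hE
    rw [h.contractSet_eq huv hF hc]
    refine ⟨hsol, (hlt hF hc).imp_left fun hs => ?_⟩
    exact ⟨hlen hF hs, IsDetour.expandSet_eq huv hF hs, F, q, Q, rfl, hs⟩
  have hexpand : ∀ E, IsSolution G A B E →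
      IsSolution G' (A.image Sum.inl) (B.image Sum.inl) (IsDetour.expandSet a u v 0 1 E) ∧
      lengthOf ℓ' (IsDetour.expandSet a u v 0 1 E) = lengthOf ℓ E + 1 ∧
      IsDetour.contractSet a u v 0 1 (IsDetour.expandSet a u v 0 1 E) = E := by
    intro E hE
    obtain ⟨F, q, Q, hF, rfl, hsol, hc⟩ := h.expand_solution hdisj hA hB ha hE
    rw [IsDetour.expandSet_eq huv hF hc, h.contractSet_eq huv hF hc.corr]
    exact ⟨hsol, hlen hF hc, rfl⟩
  have hlAB : lAB G' (A.image Sum.inl) (B.image Sum.inl) ℓ' = lAB G A B ℓ + 1 := by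
    obtain ⟨E, hE, hEl⟩ := exists_lengthOf_eq_lAB (ℓ := ℓ) hex
    obtain ⟨hE₁, hE₂, -⟩ := hexpand E hE
    obtain ⟨E', hE', hEl'⟩ := exists_lengthOf_eq_lAB (ℓ := ℓ') ⟨_, hE₁⟩
    have h₁ := lAB_le (ℓ := ℓ') hE₁
    obtain ⟨hc₁, hc₂⟩ := hcontract E' hE'
    have h₂ := lAB_le (ℓ := ℓ) hc₁
    omega
  have hmin : ∀ E, IsSolution G' (A.image Sum.inl) (B.image Sum.inl) E →
      lengthOf ℓ' E = lAB G' (A.image Sum.inl) (B.image Sum.inl) ℓ' →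
      IsSolution G A B (IsDetour.contractSet a u v 0 1 E) ∧
      lengthOf ℓ (IsDetour.contractSet a u v 0 1 E) = lAB G A B ℓ ∧
      IsDetour.expandSet a u v 0 1 (IsDetour.contractSet a u v 0 1 E) = E ∧
      ∃ F q Q, E = Sym2.map Sum.inl '' F ∪ Q ∧ IsDetour.CorrShort a u v 0 1 q Q := by
    intro E hE hEl
    obtain ⟨hc₁, ⟨hc₂, hc₃⟩ | hc₂⟩ := hcontract E hE
    · exact ⟨hc₁, by omega, hc₃⟩
    · have := lAB_le (ℓ := ℓ) hc₁
      omega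
  have hbij : Set.BijOn (IsDetour.contractSet a u v 0 1)
      {E'' | IsSolution G' (A.image Sum.inl) (B.image Sum.inl) E'' ∧
        lengthOf ℓ' E'' = lAB G' (A.image Sum.inl) (B.image Sum.inl) ℓ'}
      {E' | IsSolution G A B E' ∧ lengthOf ℓ E' = lAB G A B ℓ} := by
    refine Set.InvOn.bijOn (f' := IsDetour.expandSet a u v 0 1) ⟨?_, ?_⟩ ?_ ?_
    · exact fun E hE => (hmin E hE.1 hE.2).2.2.1
    · exact fun E hE => (hexpand E hE.1).2.2
    · exact fun E hE => ⟨(hmin E hE.1 hE.2).1, (hmin E hE.1 hE.2).2.1⟩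
    · refine fun E hE => ⟨(hexpand E hE.1).1, ?_⟩
      rw [(hexpand E hE.1).2.1, hE.2, hlAB]
  refine ⟨fun E hE hEl => ?_, hlAB, ⟨_, hbij⟩, ?_⟩
  · obtain ⟨-, -, -, F, q, Q, rfl, hc⟩ := hmin E hE hEl
    have hinter : ∀ {N : Set (Sym2 (V ⊕ Fin 3))}, (∀ e ∈ N, ∃ j, Sum.inr j ∈ e) → Q ⊆ N →
        (Sym2.map Sum.inl '' F ∪ Q) ∩ N = Q := by
      intro N hN hQN
      ext e
      refine ⟨?_, fun he => ⟨Or.inr he, hQN he⟩⟩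
      rintro ⟨he | he, heN⟩
      · obtain ⟨j, hj⟩ := hN e heN
        exact absurd hj (IsDetour.inr_notMem_of_mem_image he j)
      · exact he
    constructor
    · rw [hinter (by simp) (by
        obtain ⟨-, rfl⟩ | ⟨-, rfl⟩ := hc <;> intro e he <;> simp at he ⊢ <;> tauto)]
      exact hc.imp And.right And.right
    · rintro ε (hε | hε)
      · exact IsDetour.inr_notMem_of_mem_image hε 2
      · obtain ⟨-, rfl⟩ | ⟨-, rfl⟩ := hc <;> obtain rfl | rfl := hε <;> simp
  · rw [nSol, nSol, ← hbij.image_eq, hbij.injOn.ncard_image]
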